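/- Let $p \geq 5$ be a prime, $P = C_p \wr C_p$ with base group $A = C_p^p$, and let $\lambda$ be a non-principal irreducible character of $C_p$. Let $\varphi$ and $\psi$ be the irreducible characters of $P$ induced from the linear characters of $A$ corresponding to the $p$-tuples $(1, 0, 0, \dots, 0)$ and $(1, 1, 0, \dots, 0)$ respectively. Then $\varphi$ and $\psi$ are faithful irreducible characters of $P$, and the number of distinct irreducible constituents of $\varphi\psi$ equals the number of $P$-orbits (under cyclic permutation of coordinates) on the $p$ tuples $(2,1,0,\dots,0), (1,2,0,\dots,0), (1,1,1,0,\dots,0), (1,1,0,1,0,\dots,0), \dots, (1,1,0,\dots,0,1)$, which is exactly $p-1$. -/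

import Mathlib

/-!  Basic set-up: the regular wreath product `C_p ≀ C_p` and elementary character theory. -/

/-- The additive automorphism of `ZMod p → ZMod p` rotating the coordinates by `k`. -/
def rotAdd (p : ℕ) (k : ZMod p) : (ZMod p → ZMod p) ≃+ (ZMod p → ZMod p) where
  toFun f := fun i => f (i + k)
  invFun f := fun i => f (i - k)
  left_inv f := funext fun i => by simp
  right_inv f := funext fun i => by simp
  map_add' f g := rfl

/-- The action of `C_p` on the base group `C_p^p` by cyclically permuting the coordinates. -/
def rotHom (p : ℕ) :
    Multiplicative (ZMod p) →* MulAut (Multiplicative (ZMod p → ZMod p)) where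
  toFun k := AddEquiv.toMultiplicative (rotAdd p (Multiplicative.toAdd k))
  map_one' := MulEquiv.ext fun f =>
    congrArg Multiplicative.ofAdd (funext fun i =>
      congrArg (Multiplicative.toAdd f) (add_zero i))
  map_mul' k l := MulEquiv.ext fun f =>
    congrArg Multiplicative.ofAdd (funext fun i =>
      congrArg (Multiplicative.toAdd f)
        (add_assoc i (Multiplicative.toAdd k) (Multiplicative.toAdd l)).symm)

/-- The regular wreath product `P = C_p ≀ C_p`: the semidirect product of the base group
`A = C_p^p` with `C_p` acting by cyclically permuting the coordinates. -/
abbrev Wr (p : ℕ) : Type :=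
  Multiplicative (ZMod p → ZMod p) ⋊[rotHom p] Multiplicative (ZMod p)

noncomputable instance (p : ℕ) [NeZero p] : Fintype (Wr p) :=
  Fintype.ofEquiv (Multiplicative (ZMod p → ZMod p) × Multiplicative (ZMod p))
    { toFun := fun x => ⟨x.1, x.2⟩
      invFun := fun g => (g.left, g.right)
      left_inv := fun _ => rfl
      right_inv := fun _ => rfl }

section CharacterTheory

variable (G : Type*) [Group G]

/-- A function `G → ℂ` is a (complex) character if it is the pointwise trace of some
finite-dimensional complex matrix representation of `G`. -/
def IsCharacter (χ : G → ℂ) : Prop :=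
  ∃ (n : ℕ) (ρ : G →* Matrix.GeneralLinearGroup (Fin n) ℂ),
    ∀ g : G, χ g = Matrix.trace (ρ g : Matrix (Fin n) (Fin n) ℂ)

variable [Fintype G]

/-- The standard inner product of class functions on a finite group. -/
noncomputable def charInner (χ ψ : G → ℂ) : ℂ :=
  (Fintype.card G : ℂ)⁻¹ * ∑ g : G, χ g * (starRingEnd ℂ) (ψ g)

/-- A character is irreducible iff it has norm one with respect to the standard
inner product of class functions. -/
def IsIrreducibleCharacter (χ : G → ℂ) : Prop :=
  IsCharacter G χ ∧ charInner G χ χ = 1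

/-- A character is faithful if its kernel `{g | χ g = χ 1}` is trivial. -/
def IsFaithfulCharacter (χ : G → ℂ) : Prop :=
  ∀ g : G, χ g = χ 1 → g = 1

/-- The number of distinct irreducible constituents of a character, i.e. the number of
irreducible characters occurring in it with nonzero multiplicity. -/
noncomputable def numConstituents (χ : G → ℂ) : ℕ :=
  Set.ncard {θ : G → ℂ | IsIrreducibleCharacter G θ ∧ charInner G χ θ ≠ 0}

end CharacterTheory

section Wreath

variable (p : ℕ) [NeZero p]

/-- The character of the wreath product `C_p ≀ C_p` induced from a character `ν` of the
base group `A = C_p^p`, given by the usual induced-character formula. -/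
noncomputable def inducedFromBase (ν : Multiplicative (ZMod p → ZMod p) → ℂ) :
    Wr p → ℂ := fun g =>
  (Fintype.card (Multiplicative (ZMod p → ZMod p)) : ℂ)⁻¹ *
    ∑ x : Wr p,
      if (x * g * x⁻¹).right = 1 then ν ((x * g * x⁻¹).left) else 0

/-- The linear character `λ^{i₁} × ⋯ × λ^{iₚ}` of the base group `A = C_p^p` attached to a
character `λ` of `C_p` and the `p`-tuple `t = (i₁, …, iₚ)` of exponents modulo `p`. -/
noncomputable def tupleChar (lam : Multiplicative (ZMod p) → ℂ) (t : ZMod p → ZMod p) :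
    Multiplicative (ZMod p → ZMod p) → ℂ := fun f =>
  ∏ j : ZMod p, (lam (Multiplicative.ofAdd (Multiplicative.toAdd f j))) ^ (t j).val

/-- The embedding of `C_p` as the diagonal of the base group `C_p^p`. -/
def constHom : Multiplicative (ZMod p) →* Multiplicative (ZMod p → ZMod p) where
  toFun x := Multiplicative.ofAdd fun _ => Multiplicative.toAdd x
  map_one' := rfl
  map_mul' _ _ := rfl

/-- The diagonal subgroup `{(x, …, x) ∣ x ∈ C_p}` of the base group, inside `C_p ≀ C_p`. -/
def diagonalSubgroup : Subgroup (Wr p) :=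
  (SemidirectProduct.inl.comp (constHom p)).range

end Wreath

section Helpers

set_option linter.unusedSectionVars false

variable {G : Type*} [Group G]

lemma isCharacter_of_matrix {ι : Type*} [Fintype ι] [DecidableEq ι] (ρ : G →* Matrix ι ι ℂ)
    (χ : G → ℂ) (h : ∀ g, χ g = Matrix.trace (ρ g)) : IsCharacter G χ := by
  let e := Fintype.equivFin ι
  let ρ' : G →* Matrix (Fin (Fintype.card ι)) (Fin (Fintype.card ι)) ℂ :=
    ((Matrix.reindexAlgEquiv ℂ ℂ e : Matrix ι ι ℂ →* _)).comp ρ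
  refine ⟨Fintype.card ι, ρ'.toHomUnits, fun g => ?_⟩
  rw [h]
  simp only [Matrix.trace, MonoidHom.coe_toHomUnits, ρ']
  rw [← Equiv.sum_comp e]
  simp

variable [Fintype G]

lemma charInner_nat (χ θ : G → ℂ) (hχ : IsCharacter G χ) (hθ : IsCharacter G θ) :
    ∃ n : ℕ, charInner G χ θ = n := by
  obtain ⟨n, ρ, hρ⟩ := hχ
  obtain ⟨m, σ, hσ⟩ := hθ
  let τ : G →* Matrix (Fin n × Fin m) (Fin n × Fin m) ℂ :=
    { toFun := fun g => Matrix.kroneckerMap (fun x y => x * y) (ρ g : Matrix (Fin n) (Fin n) ℂ)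
        ((σ g : Matrix (Fin m) (Fin m) ℂ).map (starRingEnd ℂ))
      map_one' := by simp
      map_mul' := fun g h => by
        rw [← Matrix.mul_kronecker_mul]
        simp }
  let R : Representation ℂ G (Fin n × Fin m → ℂ) :=
    ((Matrix.toLinAlgEquiv' : Matrix (Fin n × Fin m) (Fin n × Fin m) ℂ ≃ₐ[ℂ] _) :
      Matrix (Fin n × Fin m) (Fin n × Fin m) ℂ →* _).comp τ
  have hc : (Nat.card G : ℂ) ≠ 0 := by
    simp
  let _ : Invertible (Nat.card G : ℂ) := invertibleOfNonzero hc
  have key := R.card_inv_mul_sum_char_eq_finrank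
  refine ⟨_, Eq.trans ?_ key⟩
  unfold charInner
  rw [Nat.card_eq_fintype_card]
  congr 1
  refine Finset.sum_congr rfl fun g _ => ?_
  have : R.character g = Matrix.trace (τ g) := by
    simp only [Representation.character, R]
    exact Matrix.trace_toLin'_eq _
  rw [this]
  have h2 : τ g = Matrix.kroneckerMap (fun x y => x * y) (ρ g : Matrix (Fin n) (Fin n) ℂ)
        ((σ g : Matrix (Fin m) (Fin m) ℂ).map (starRingEnd ℂ)) := rfl
  rw [h2, Matrix.trace_kronecker, hρ, hσ]
  congr 1
  simp [Matrix.trace]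

lemma charInner_self (χ : G → ℂ) :
    charInner G χ χ = (((Fintype.card G : ℝ)⁻¹ * ∑ g, ‖χ g‖ ^ 2 : ℝ) : ℂ) := by
  unfold charInner
  push_cast
  congr 1
  refine Finset.sum_congr rfl fun g _ => ?_
  rw [Complex.mul_conj, Complex.normSq_eq_norm_sq]
  push_cast
  rfl

lemma eq_zero_of_charInner_self (χ : G → ℂ) (h : charInner G χ χ = 0) : χ = 0 := by
  rw [charInner_self, Complex.ofReal_eq_zero] at h
  have hc : ((Fintype.card G : ℝ)⁻¹) ≠ 0 := by
    have := Fintype.card_ne_zero (α := G)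
    positivity
  have h := (mul_eq_zero.mp h).resolve_left hc
  rw [Finset.sum_eq_zero_iff_of_nonneg (fun _ _ => by positivity)] at h
  funext g
  simpa using h g (Finset.mem_univ g)

lemma charInner_sub_smul (χ θ : G → ℂ) (c : ℝ) :
    charInner G (fun g => χ g - c * θ g) (fun g => χ g - c * θ g) =
      charInner G χ χ - c * charInner G χ θ - c * charInner G θ χ
        + c ^ 2 * charInner G θ θ := by
  unfold charInner
  have : ∀ g, (χ g - c * θ g) * (starRingEnd ℂ) (χ g - c * θ g) =
      χ g * (starRingEnd ℂ) (χ g) - c * (χ g * (starRingEnd ℂ) (θ g))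
       - c * (θ g * (starRingEnd ℂ) (χ g)) + c ^ 2 * (θ g * (starRingEnd ℂ) (θ g)) := by
    intro g
    simp only [map_sub, map_mul, Complex.conj_ofReal]
    ring
  simp only [this, Finset.sum_add_distrib, Finset.sum_sub_distrib, ← Finset.mul_sum]
  ring

lemma charInner_conj (χ θ : G → ℂ) :
    charInner G χ θ = (starRingEnd ℂ) (charInner G θ χ) := by
  unfold charInner
  simp only [map_mul, map_inv₀, map_natCast, map_sum, Complex.conj_conj]
  congr 1
  exact Finset.sum_congr rfl fun g _ => mul_comm _ _

/-- Two irreducible characters with nonzero inner product coincide. -/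
lemma eq_of_charInner_ne_zero (χ θ : G → ℂ) (hχ : IsIrreducibleCharacter G χ)
    (hθ : IsIrreducibleCharacter G θ) (h : charInner G χ θ ≠ 0) : χ = θ := by
  obtain ⟨n, hn⟩ := charInner_nat χ θ hχ.1 hθ.1
  have hn' : charInner G θ χ = n := by rw [charInner_conj, hn]; simp
  have hn0 : n ≠ 0 := by rintro rfl; simp [hn] at h
  have e1 := charInner_sub_smul χ θ 1
  rw [hχ.2, hθ.2, hn, hn', charInner_self] at e1
  have e2 : ((Fintype.card G : ℝ)⁻¹ * ∑ g, ‖χ g - ((1 : ℝ) : ℂ) * θ g‖ ^ 2 : ℝ) = 2 - 2 * n := by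
    have : (((Fintype.card G : ℝ)⁻¹ * ∑ g, ‖χ g - ((1 : ℝ) : ℂ) * θ g‖ ^ 2 : ℝ) : ℂ)
        = ((2 - 2 * n : ℝ) : ℂ) := by
      rw [e1]; push_cast; ring
    exact_mod_cast this
  have e3 : (0 : ℝ) ≤ 2 - 2 * n := by rw [← e2]; positivity
  have hn1 : n = 1 := by
    have : (n : ℝ) ≤ 1 := by linarith
    have : n ≤ 1 := by exact_mod_cast this
    omega
  subst hn1
  have := eq_zero_of_charInner_self (fun g => χ g - ((1 : ℝ) : ℂ) * θ g)
    (by rw [charInner_self, e2]; simp)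
  funext g
  have h3 := congrFun this g
  simp only [Complex.ofReal_one, one_mul, Pi.zero_apply] at h3
  exact sub_eq_zero.mp h3

lemma charInner_sum {ι : Type*} (s : Finset ι) (f : ι → G → ℂ) (θ : G → ℂ) :
    charInner G (fun g => ∑ i ∈ s, f i g) θ = ∑ i ∈ s, charInner G (f i) θ := by
  unfold charInner
  simp only [Finset.sum_mul, ← Finset.mul_sum]
  rw [Finset.sum_comm]

end Helpers

section Cyc

variable {p : ℕ} [Fact p.Prime]

lemma lam_eq (lam : Multiplicative (ZMod p) → ℂ)
    (hlam : IsIrreducibleCharacter (Multiplicative (ZMod p)) lam)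
    (hlam' : lam ≠ fun _ => 1) :
    ∃ e : AddChar (ZMod p) ℂ, e.IsPrimitive ∧ ∀ x, lam x = e (Multiplicative.toAdd x) := by
  have h0 : lam ≠ 0 := by
    rintro rfl
    have := hlam.2
    simp [charInner] at this
  have h1 : ZMod.dft (fun j : ZMod p => lam (Multiplicative.ofAdd j)) ≠ 0 := by
    intro h
    rw [LinearEquiv.map_eq_zero_iff] at h
    exact h0 (funext fun x => congrFun h (Multiplicative.toAdd x))
  obtain ⟨k, hk⟩ := Function.ne_iff.mp h1
  rw [ZMod.dft_apply, Pi.zero_apply] at hk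
  let e : AddChar (ZMod p) ℂ := ZMod.stdAddChar.mulShift k
  let μ : Multiplicative (ZMod p) → ℂ := fun x => e (Multiplicative.toAdd x)
  have hμ : IsIrreducibleCharacter (Multiplicative (ZMod p)) μ := by
    constructor
    · refine isCharacter_of_matrix (ι := Unit)
        ((Matrix.uniqueAlgEquiv (R := ℂ) (A := ℂ) (m := Unit)).symm.toMonoidHom.comp
          e.toMonoidHom) _ fun g => ?_
      simp [Matrix.trace, μ]
    · have : ∀ x, μ x * (starRingEnd ℂ) (μ x) = 1 := by
        intro x
        simp only [μ]
        rw [← AddChar.map_neg_eq_conj, ← AddChar.map_add_eq_mul]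
        simp
      simp [charInner, this, (Fact.out : p.Prime).ne_zero]
  have hne : charInner _ lam μ ≠ 0 := by
    unfold charInner
    refine mul_ne_zero (by simp [(Fact.out : p.Prime).ne_zero]) ?_
    convert hk using 1
    refine Fintype.sum_equiv Multiplicative.toAdd _ _ fun x => ?_
    simp only [μ, e]
    rw [← AddChar.map_neg_eq_conj, AddChar.mulShift_apply, smul_eq_mul, mul_comm]
    congr 2
    change k * (-(Multiplicative.toAdd x)) = -((Multiplicative.toAdd x) * k)
    ring
  have heq := eq_of_charInner_ne_zero _ _ hlam hμ hne
  refine ⟨e, AddChar.IsPrimitive.of_ne_one ?_, fun x => congrFun heq x⟩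
  intro he
  apply hlam'
  rw [heq]
  funext x
  simp [μ, he]

end Cyc

section Ind

variable {p : ℕ} [Fact p.Prime]

/-- Explicit formula for the induced character attached to the tuple `t`. -/
noncomputable def indT (e : AddChar (ZMod p) ℂ) (t : ZMod p → ZMod p) : Wr p → ℂ := fun g =>
  if g.right = 1 then ∑ c : ZMod p, e (∑ j, Multiplicative.toAdd g.left j * t (j + c)) else 0

lemma addChar_sum {ι : Type*} (e : AddChar (ZMod p) ℂ) (s : Finset ι) (f : ι → ZMod p) :
    e (∑ i ∈ s, f i) = ∏ i ∈ s, e (f i) := by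
  classical
  induction s using Finset.induction_on with
  | empty => simp
  | insert a s ha ih => rw [Finset.sum_insert ha, Finset.prod_insert ha, e.map_add_eq_mul, ih]

lemma tupleChar_eq (lam : Multiplicative (ZMod p) → ℂ) (e : AddChar (ZMod p) ℂ)
    (he : ∀ x, lam x = e (Multiplicative.toAdd x)) (t : ZMod p → ZMod p)
    (f : Multiplicative (ZMod p → ZMod p)) :
    tupleChar p lam t f = e (∑ j, Multiplicative.toAdd f j * t j) := by
  rw [addChar_sum]
  unfold tupleChar
  refine Finset.prod_congr rfl fun j _ => ?_
  rw [he, ← AddChar.map_nsmul_eq_pow]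
  congr 1
  rw [nsmul_eq_mul, ZMod.natCast_zmod_val, mul_comm]
  rfl

lemma wr_sum (F : Wr p → ℂ) :
    ∑ x : Wr p, F x = ∑ b : ZMod p → ZMod p, ∑ c : ZMod p,
      F ⟨Multiplicative.ofAdd b, Multiplicative.ofAdd c⟩ := by
  rw [← Fintype.sum_prod_type' (f := fun (b : ZMod p → ZMod p) (c : ZMod p) =>
    F ⟨Multiplicative.ofAdd b, Multiplicative.ofAdd c⟩)]
  symm
  refine Fintype.sum_equiv (
    { toFun := fun x => ⟨Multiplicative.ofAdd x.1, Multiplicative.ofAdd x.2⟩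
      invFun := fun g => (Multiplicative.toAdd g.left, Multiplicative.toAdd g.right)
      left_inv := fun _ => rfl
      right_inv := fun _ => rfl } : (ZMod p → ZMod p) × ZMod p ≃ Wr p) _ _ fun x => rfl

lemma wr_card : Fintype.card (Wr p) = p ^ p * p := by
  have : Fintype.card (Wr p) =
      Fintype.card (Multiplicative (ZMod p → ZMod p) × Multiplicative (ZMod p)) :=
    Fintype.ofEquiv_card _
  rw [this]
  simp [ZMod.card]

lemma rot_apply (c : ZMod p) (a : Multiplicative (ZMod p → ZMod p)) (j : ZMod p) :
    Multiplicative.toAdd (rotHom p (Multiplicative.ofAdd c) a) j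
      = Multiplicative.toAdd a (j + c) := rfl

lemma induced_eq (lam : Multiplicative (ZMod p) → ℂ) (e : AddChar (ZMod p) ℂ)
    (he : ∀ x, lam x = e (Multiplicative.toAdd x)) (t : ZMod p → ZMod p) :
    inducedFromBase p (tupleChar p lam t) = indT e t := by
  funext g
  unfold inducedFromBase indT
  have hr : ∀ x : Wr p, (x * g * x⁻¹).right = g.right := by
    intro x
    simp only [SemidirectProduct.mul_right, SemidirectProduct.inv_right]
    rw [mul_comm x.right, mul_inv_cancel_right]
  simp only [hr]
  split_ifs with h
  · have hl : ∀ x : Wr p, (x * g * x⁻¹).left = rotHom p x.right g.left := by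
      intro x
      simp only [SemidirectProduct.mul_left, SemidirectProduct.inv_left,
        SemidirectProduct.mul_right, h, mul_one]
      rw [map_inv, map_inv, map_inv, MulAut.apply_inv_self, mul_comm x.left, mul_inv_cancel_right]
    simp only [hl, tupleChar_eq lam e he]
    rw [wr_sum]
    simp only [Finset.sum_const, Finset.card_univ, nsmul_eq_mul]
    rw [show Fintype.card (Multiplicative (ZMod p → ZMod p))
      = Fintype.card (ZMod p → ZMod p) from Fintype.card_multiplicative _]
    rw [inv_mul_cancel_left₀ (by exact_mod_cast Fintype.card_ne_zero)]
    refine Fintype.sum_equiv (Equiv.neg _) _ _ fun c => ?_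
    congr 1
    refine Fintype.sum_equiv (Equiv.addRight c) _ _ fun j => ?_
    rw [rot_apply]
    simp
  · simp

lemma indT_isCharacter (e : AddChar (ZMod p) ℂ) (t : ZMod p → ZMod p) :
    IsCharacter (Wr p) (indT e t) := by
  let N : (ZMod p → ZMod p) → ZMod p → ℂ := fun a c => e (∑ j, a (j + c) * t j)
  let ρ : Wr p →* Matrix (ZMod p) (ZMod p) ℂ :=
    { toFun := fun g => Matrix.of fun c c' =>
        if c' = c + Multiplicative.toAdd g.right then N (Multiplicative.toAdd g.left) c else 0
      map_one' := by
        ext c c'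
        simp [Matrix.one_apply, N, eq_comm]
      map_mul' := fun g h => by
        ext c c'
        simp only [Matrix.mul_apply, Matrix.of_apply, ite_mul, zero_mul]
        rw [Finset.sum_ite_eq' Finset.univ (c + Multiplicative.toAdd g.right)]
        simp only [Finset.mem_univ, if_true, SemidirectProduct.mul_right,
          SemidirectProduct.mul_left, toAdd_mul, ← add_assoc]
        split_ifs with hc
        · simp only [N]
          rw [← e.map_add_eq_mul, ← Finset.sum_add_distrib]
          congr 1
          refine Finset.sum_congr rfl fun j _ => ?_
          rw [← add_mul]
          congr 1
          rw [Pi.add_apply]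
          congr 1
          change Multiplicative.toAdd h.left (j + c + _) = _
          rw [add_assoc]
        · simp }
  refine isCharacter_of_matrix ρ _ fun g => ?_
  unfold indT
  simp only [Matrix.trace, Matrix.diag, ρ, MonoidHom.coe_mk, OneHom.coe_mk, Matrix.of_apply,
    left_eq_add]
  have : Multiplicative.toAdd g.right = 0 ↔ g.right = 1 := Iff.rfl
  simp only [this]
  split_ifs with h
  · refine Fintype.sum_equiv (Equiv.neg _) _ _ fun c => ?_
    simp only [N]
    congr 1
    refine Fintype.sum_equiv (Equiv.addRight c) _ _ fun j => ?_
    simp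
  · simp

lemma sum_e (e : AddChar (ZMod p) ℂ) (he : e.IsPrimitive) (u : ZMod p → ZMod p) :
    ∑ a : ZMod p → ZMod p, e (∑ j, a j * u j) = if u = 0 then (p : ℂ) ^ p else 0 := by
  simp only [addChar_sum]
  have := Finset.prod_univ_sum (fun _ : ZMod p => (Finset.univ : Finset (ZMod p)))
    (fun j x => e (x * u j))
  rw [Fintype.piFinset_univ] at this
  rw [← this]
  simp only [AddChar.sum_mulShift _ he, ZMod.card]
  split_ifs with h
  · subst h; simp [ZMod.card]
  · obtain ⟨j, hj⟩ := Function.ne_iff.mp h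
    refine Finset.prod_eq_zero (Finset.mem_univ j) ?_
    simp only [Pi.zero_apply] at hj
    simp [hj]

lemma indT_inner (e : AddChar (ZMod p) ℂ) (he : e.IsPrimitive) (t s : ZMod p → ZMod p) :
    charInner (Wr p) (indT e t) (indT e s) =
      ((Finset.univ.filter fun c : ZMod p => ∀ j, s j = t (j + c)).card : ℂ) := by
  have hp0 : (p : ℂ) ≠ 0 := by exact_mod_cast (Fact.out : p.Prime).ne_zero
  unfold charInner
  rw [wr_card, wr_sum]
  have h1 : ∀ b : ZMod p → ZMod p, ∑ c : ZMod p,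
      indT e t ⟨Multiplicative.ofAdd b, Multiplicative.ofAdd c⟩ *
        (starRingEnd ℂ) (indT e s ⟨Multiplicative.ofAdd b, Multiplicative.ofAdd c⟩) =
      ∑ d : ZMod p, ∑ c : ZMod p, e (∑ j, b j * (t (j + c) - s (j + d))) := by
    intro b
    rw [Finset.sum_eq_single 0]
    · simp only [indT, ofAdd_zero, if_true, toAdd_ofAdd]
      rw [map_sum, Finset.sum_mul_sum, Finset.sum_comm]
      refine Finset.sum_congr rfl fun d _ => Finset.sum_congr rfl fun c _ => ?_
      rw [← AddChar.map_neg_eq_conj, ← e.map_add_eq_mul]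
      congr 1
      rw [← Finset.sum_neg_distrib, ← Finset.sum_add_distrib]
      refine Finset.sum_congr rfl fun j _ => ?_
      ring
    · intro c _ hc
      have : Multiplicative.ofAdd c ≠ 1 := hc
      simp [indT, this]
    · simp
  simp only [h1]
  rw [Finset.sum_comm]
  have h2 : ∀ d : ZMod p, ∑ b : ZMod p → ZMod p, ∑ c : ZMod p,
      e (∑ j, b j * (t (j + c) - s (j + d))) =
      (p : ℂ) ^ p *
        ((Finset.univ.filter fun c : ZMod p => ∀ j, s j = t (j + c)).card : ℂ) := by
    intro d
    rw [Finset.sum_comm]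
    have h3 : ∀ c : ZMod p, ∑ b : ZMod p → ZMod p,
        e (∑ j, b j * (t (j + c) - s (j + d))) =
        if ∀ j, s j = t (j + (c - d)) then (p : ℂ) ^ p else 0 := by
      intro c
      rw [sum_e e he (fun j => t (j + c) - s (j + d))]
      congr 1
      apply propext
      rw [funext_iff]
      constructor
      · intro h j
        have := h (j - d)
        simp only [Pi.zero_apply, sub_add_cancel] at this
        rw [← sub_eq_zero.mp this]
        congr 1
        ring
      · intro h j
        simp only [Pi.zero_apply]
        rw [h (j + d), sub_eq_zero]
        congr 1
        ring
    simp only [h3]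
    rw [Fintype.sum_equiv (Equiv.subRight d) _
      (fun c => if ∀ j, s j = t (j + c) then (p : ℂ) ^ p else 0) (fun c => by simp)]
    rw [Finset.sum_ite]
    simp [mul_comm]
  simp only [h2, Finset.sum_const, Finset.card_univ, ZMod.card]
  push_cast
  rw [nsmul_eq_mul]
  field_simp

/-- Nonzero coordinate sum forces trivial stabiliser. -/
lemma shift_trivial (t : ZMod p → ZMod p) (ht : ∑ j, t j ≠ 0) (c : ZMod p)
    (h : ∀ j, t j = t (j + c)) : c = 0 := by
  have h1 : ∑ j, j * t j = ∑ j, (j + c) * t (j + c) :=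
    (Fintype.sum_equiv (Equiv.addRight c) _ _ fun j => rfl).symm
  have h2 : ∑ j, (j + c) * t (j + c) = ∑ j, j * t j + c * ∑ j, t j := by
    rw [Finset.mul_sum, ← Finset.sum_add_distrib]
    refine Finset.sum_congr rfl fun j _ => ?_
    rw [← h j]
    ring
  rw [h2, left_eq_add] at h1
  exact (mul_eq_zero.mp h1).resolve_right ht

lemma indT_irr (e : AddChar (ZMod p) ℂ) (he : e.IsPrimitive) (t : ZMod p → ZMod p)
    (ht : ∑ j, t j ≠ 0) : IsIrreducibleCharacter (Wr p) (indT e t) := by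
  refine ⟨indT_isCharacter e t, ?_⟩
  rw [indT_inner e he]
  have : (Finset.univ.filter fun c : ZMod p => ∀ j, t j = t (j + c)) = {0} := by
    ext c
    simp only [Finset.mem_filter, Finset.mem_univ, true_and, Finset.mem_singleton]
    exact ⟨shift_trivial t ht c, by rintro rfl; simp⟩
  rw [this]
  simp

lemma norm_e (e : AddChar (ZMod p) ℂ) (x : ZMod p) : ‖e x‖ = 1 := by
  exact e.norm_apply x

/-- If `∑ e(x_c) = p` then every `x_c = 0`. -/
lemma all_zero (e : AddChar (ZMod p) ℂ) (he : e.IsPrimitive) (x : ZMod p → ZMod p)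
    (h : ∑ c, e (x c) = p) (c : ZMod p) : x c = 0 := by
  rw [← he.zmod_char_eq_one_iff p (x c)]
  have h1 : ∑ c, (1 - (e (x c)).re) = 0 := by
    have := congrArg Complex.re h
    rw [Complex.re_sum, Complex.natCast_re] at this
    rw [Finset.sum_sub_distrib, this]
    simp [ZMod.card]
  have hle : ∀ c, (e (x c)).re ≤ 1 := fun c =>
    (Complex.re_le_norm _).trans (norm_e e _).le
  rw [Finset.sum_eq_zero_iff_of_nonneg (fun c _ => by linarith [hle c])] at h1
  have hre : (e (x c)).re = 1 := by linarith [h1 c (Finset.mem_univ c)]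
  have hn := norm_e e (x c)
  have hsq : (e (x c)).re ^ 2 + (e (x c)).im ^ 2 = 1 := by
    rw [← Complex.sq_norm_sub_sq_re, hn]; ring
  have him : (e (x c)).im = 0 := by
    rw [hre] at hsq
    have : (e (x c)).im ^ 2 = 0 := by linarith
    exact pow_eq_zero_iff (two_ne_zero) |>.mp this
  exact Complex.ext (by simpa using hre) (by simpa using him)

lemma indT_faithful (e : AddChar (ZMod p) ℂ) (he : e.IsPrimitive) (t : ZMod p → ZMod p)
    (ht : ∀ a : ZMod p → ZMod p, (∀ c, ∑ j, a j * t (j + c) = 0) → a = 0) :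
    IsFaithfulCharacter (Wr p) (indT e t) := by
  have hp0 : (p : ℂ) ≠ 0 := by exact_mod_cast (Fact.out : p.Prime).ne_zero
  have h1 : indT e t 1 = p := by
    simp [indT, ZMod.card]
  intro g hg
  rw [h1] at hg
  unfold indT at hg
  split_ifs at hg with hr
  · have := ht (Multiplicative.toAdd g.left) (all_zero e he _ hg)
    exact SemidirectProduct.ext this hr
  · exact absurd hg.symm hp0

end Ind

section Tuples

variable {p : ℕ} [Fact p.Prime]

lemma natCast_small_ne (hp : 5 ≤ p) (n : ℕ) (h0 : 0 < n) (h : n < 5) : ((n : ℕ) : ZMod p) ≠ 0 := by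
  intro h1
  rw [ZMod.natCast_eq_zero_iff] at h1
  have := Nat.le_of_dvd h0 h1
  omega

/-- The tuple `(1,0,…,0)`. -/
def tA : ZMod p → ZMod p := fun j => if j = 0 then 1 else 0

/-- The tuple `(1,1,0,…,0)`. -/
def tB : ZMod p → ZMod p := fun j => (if j = 0 then 1 else 0) + (if j = 1 then 1 else 0)

/-- The tuple `(1,1,0,…,0) + e_m`. -/
def tT (m : ZMod p) : ZMod p → ZMod p := fun j =>
  (if j = m then 1 else 0) + ((if j = 0 then 1 else 0) + (if j = 1 then 1 else 0))

lemma tB_eq : (fun j : ZMod p => if j = 0 ∨ j = 1 then (1 : ZMod p) else 0) = tB := by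
  funext j
  unfold tB
  have := one_ne_zero (α := ZMod p)
  by_cases h0 : j = 0 <;> by_cases h1 : j = 1 <;> simp_all

lemma tuples_eq : ({fun j => if j = 0 then 2 else if j = 1 then 1 else 0,
       fun j => if j = 0 then 1 else if j = 1 then 2 else 0} ∪
        (fun k : ZMod p => fun j : ZMod p =>
            if j = 0 ∨ j = 1 ∨ j = k then (1 : ZMod p) else 0) ''
          {k : ZMod p | k ≠ 0 ∧ k ≠ 1} : Set (ZMod p → ZMod p)) = Set.range tT := by
  have h10 := one_ne_zero (α := ZMod p)
  have e0 : (fun j : ZMod p => if j = 0 then (2 : ZMod p) else if j = 1 then 1 else 0) = tT 0 := by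
    funext j
    unfold tT
    by_cases h0 : j = 0 <;> by_cases h1 : j = 1 <;> simp_all [one_add_one_eq_two]
  have e1 : (fun j : ZMod p => if j = 0 then (1 : ZMod p) else if j = 1 then 2 else 0) = tT 1 := by
    funext j
    unfold tT
    by_cases h0 : j = 0 <;> by_cases h1 : j = 1 <;> simp_all [one_add_one_eq_two]
  have e2 : ∀ k : ZMod p, k ≠ 0 → k ≠ 1 →
      (fun j : ZMod p => if j = 0 ∨ j = 1 ∨ j = k then (1 : ZMod p) else 0) = tT k := by
    intro k hk0 hk1
    funext j
    unfold tT
    by_cases h0 : j = 0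
    · subst h0; simp [hk0.symm, h10.symm]
    · by_cases h1 : j = 1
      · subst h1; simp [hk1.symm]
      · by_cases h2 : j = k <;> simp [h0, h1, h2]
        simp [hk0, hk1]
  rw [e0, e1]
  ext t
  constructor
  · rintro ((rfl | rfl) | ⟨k, ⟨hk0, hk1⟩, rfl⟩)
    · exact ⟨0, rfl⟩
    · exact ⟨1, rfl⟩
    · exact ⟨k, (e2 k hk0 hk1).symm⟩
  · rintro ⟨m, rfl⟩
    by_cases h0 : m = 0
    · subst h0; left; left; rfl
    · by_cases h1 : m = 1
      · subst h1; left; right; rfl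
      · right; exact ⟨m, ⟨h0, h1⟩, e2 m h0 h1⟩

lemma tT_sum (hp3 : (3 : ZMod p) ≠ 0) (m : ZMod p) : ∑ j, tT m j ≠ 0 := by
  have : ∑ j, tT m j = 3 := by
    simp [tT, Finset.sum_add_distrib]
    norm_num
  rw [this]
  exact hp3

lemma indT_prod (e : AddChar (ZMod p) ℂ) (g : Wr p) :
    indT e tA g * indT e tB g = ∑ m : ZMod p, indT e (tT m) g := by
  unfold indT
  split_ifs with h
  · rw [Finset.sum_mul_sum, Finset.sum_comm]
    rw [Finset.sum_comm (s := (Finset.univ : Finset (ZMod p)))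
      (f := fun m c => e (∑ j, Multiplicative.toAdd g.left j * tT m (j + c)))]
    refine Finset.sum_congr rfl fun d _ => ?_
    refine Fintype.sum_equiv (Equiv.subLeft d) _ _ fun c => ?_
    rw [← e.map_add_eq_mul, ← Finset.sum_add_distrib]
    congr 1
    refine Finset.sum_congr rfl fun j _ => ?_
    rw [← mul_add]
    congr 1
    simp only [tA, tB, tT, Equiv.subLeft_apply]
    congr 1
    have : j + c = 0 ↔ j + d = d - c := by
      constructor
      · intro h; linear_combination h
      · intro h; linear_combination h
    simp only [this]
  · simp

/-- The orbit of a tuple under cyclic shifts. -/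
def orb (t : ZMod p → ZMod p) : Set (ZMod p → ZMod p) :=
  {s : ZMod p → ZMod p | ∃ k : ZMod p, ∀ j : ZMod p, s j = t (j + k)}

lemma orb_eq_iff (t s : ZMod p → ZMod p) : orb t = orb s ↔ ∃ k, ∀ j, s j = t (j + k) := by
  constructor
  · intro h
    have : s ∈ orb s := ⟨0, by simp⟩
    rw [← h] at this
    exact this
  · rintro ⟨k, hk⟩
    ext u
    constructor
    · rintro ⟨l, hl⟩
      refine ⟨l - k, fun j => ?_⟩
      rw [hl, hk]
      congr 1
      ring
    · rintro ⟨l, hl⟩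
      refine ⟨l + k, fun j => ?_⟩
      rw [hl, hk]
      congr 1
      ring

lemma indT_inner_ne (e : AddChar (ZMod p) ℂ) (he : e.IsPrimitive) (t s : ZMod p → ZMod p) :
    charInner (Wr p) (indT e t) (indT e s) ≠ 0 ↔ orb t = orb s := by
  rw [indT_inner e he, orb_eq_iff, Nat.cast_ne_zero, ← Nat.pos_iff_ne_zero, Finset.card_pos]
  constructor
  · rintro ⟨c, hc⟩
    exact ⟨c, by simpa using hc⟩
  · rintro ⟨c, hc⟩
    exact ⟨c, by simpa using hc⟩

lemma indT_eq_iff (e : AddChar (ZMod p) ℂ) (he : e.IsPrimitive) (t s : ZMod p → ZMod p)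
    (ht : ∑ j, t j ≠ 0) (hs : ∑ j, s j ≠ 0) :
    indT e t = indT e s ↔ orb t = orb s := by
  rw [← indT_inner_ne e he]
  constructor
  · intro h
    rw [h, (indT_irr e he s hs).2]
    exact one_ne_zero
  · exact eq_of_charInner_ne_zero _ _ (indT_irr e he t ht) (indT_irr e he s hs)

lemma count_eq (e : AddChar (ZMod p) ℂ) (he : e.IsPrimitive) (hp3 : (3 : ZMod p) ≠ 0) :
    numConstituents (Wr p) (fun g => ∑ m : ZMod p, indT e (tT m) g) =
      Set.ncard (orb '' Set.range (tT (p := p))) := by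
  unfold numConstituents
  have hset : {θ : Wr p → ℂ | IsIrreducibleCharacter (Wr p) θ ∧
      charInner (Wr p) (fun g => ∑ m : ZMod p, indT e (tT m) g) θ ≠ 0} =
      indT e '' Set.range tT := by
    ext θ
    simp only [Set.mem_setOf_eq, charInner_sum]
    constructor
    · rintro ⟨hθ, h⟩
      obtain ⟨m, -, hm⟩ := Finset.exists_ne_zero_of_sum_ne_zero h
      exact ⟨tT m, ⟨m, rfl⟩,
        eq_of_charInner_ne_zero _ _ (indT_irr e he _ (tT_sum hp3 m)) hθ hm⟩
    · rintro ⟨_, ⟨n, rfl⟩, rfl⟩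
      refine ⟨indT_irr e he _ (tT_sum hp3 n), ?_⟩
      simp only [indT_inner e he]
      rw [← Nat.cast_sum, Nat.cast_ne_zero]
      intro h0
      have := (Finset.sum_eq_zero_iff.mp h0) n (Finset.mem_univ n)
      apply (indT_inner_ne e he (tT n) (tT n)).mpr rfl
      rw [indT_inner e he, this]
      simp
  rw [hset]
  have hinj : Set.InjOn (fun s : Set (ZMod p → ZMod p) => indT e (Classical.epsilon fun t =>
      t ∈ Set.range tT ∧ orb t = s)) (orb '' Set.range (tT (p := p))) := by
    rintro _ ⟨t, ht, rfl⟩ _ ⟨s, hs, rfl⟩ h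
    have h1 := Classical.epsilon_spec (p := fun t' => t' ∈ Set.range tT ∧ orb t' = orb t)
      ⟨t, ht, rfl⟩
    have h2 := Classical.epsilon_spec (p := fun t' => t' ∈ Set.range tT ∧ orb t' = orb s)
      ⟨s, hs, rfl⟩
    obtain ⟨⟨m, hm⟩, h1⟩ := h1
    obtain ⟨⟨n, hn⟩, h2⟩ := h2
    rw [← h1, ← h2]
    refine (indT_eq_iff e he _ _ ?_ ?_).mp h
    · rw [← hm]; exact tT_sum hp3 m
    · rw [← hn]; exact tT_sum hp3 n
  rw [← Set.InjOn.ncard_image hinj, Set.image_image]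
  congr 1
  apply Set.image_congr
  intro t ht
  obtain ⟨⟨m, hm⟩, h1⟩ :=
    Classical.epsilon_spec (p := fun t' => t' ∈ Set.range tT ∧ orb t' = orb t) ⟨t, ht, rfl⟩
  obtain ⟨n, rfl⟩ := ht
  symm
  refine (indT_eq_iff e he _ _ ?_ (tT_sum hp3 n)).mpr h1
  rw [← hm]; exact tT_sum hp3 m

lemma tT_ne_zero_iff (hp2 : (2 : ZMod p) ≠ 0) (hp3 : (3 : ZMod p) ≠ 0) (m j : ZMod p) :
    tT m j ≠ 0 ↔ j = 0 ∨ j = 1 ∨ j = m := by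
  unfold tT
  have h10 := one_ne_zero (α := ZMod p)
  by_cases h0 : j = 0 <;> by_cases h1 : j = 1 <;> by_cases h2 : j = m <;>
    simp [h0, h1, h2] <;> simp_all [one_add_one_eq_two]

lemma tT_inj (hp2 : (2 : ZMod p) ≠ 0) {m n : ZMod p} (h : tT m = tT n) : m = n := by
  by_contra hne
  have := congrFun h m
  simp only [tT, if_true, hne, if_false] at this
  rw [zero_add, add_eq_right] at this
  exact one_ne_zero this

lemma orbit_inj (hp2 : (2 : ZMod p) ≠ 0) (hp3 : (3 : ZMod p) ≠ 0) {m n : ZMod p}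
    (hm : m ≠ -1) (hn : n ≠ -1) (h : orb (tT m) = orb (tT n)) : m = n := by
  obtain ⟨c, hc⟩ := (orb_eq_iff _ _).mp h
  have hs : ∀ j, (j = 0 ∨ j = 1 ∨ j = n) ↔ (j + c = 0 ∨ j + c = 1 ∨ j + c = m) := by
    intro j
    rw [← tT_ne_zero_iff hp2 hp3 n, hc, tT_ne_zero_iff hp2 hp3]
  have hc0 : c = 0 := by
    have a0 := (hs 0).mp (by simp)
    have a1 := (hs 1).mp (by simp)
    rw [zero_add] at a0
    rcases a0 with h0 | h0 | h0
    · exact h0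
    · subst h0
      exfalso
      have := (hs (-1)).mpr (by simp)
      rcases this with h1 | h1 | h1
      · exact one_ne_zero (neg_eq_zero.mp h1)
      · exact hp2 (by linear_combination -h1)
      · exact hn h1.symm
    · subst h0
      rcases a1 with h1 | h1 | h1
      · exact absurd (by linear_combination h1) hm
      · simpa using h1
      · simp at h1
  subst hc0
  refine (tT_inj hp2 ?_)
  funext j
  rw [hc, add_zero]

lemma orbit_count (hp : 5 ≤ p) (hp2 : (2 : ZMod p) ≠ 0) (hp3 : (3 : ZMod p) ≠ 0) :
    Set.ncard (orb '' Set.range (tT (p := p))) = p - 1 := by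
  have h1 : orb '' Set.range (tT (p := p)) = (fun m => orb (tT m)) '' {m : ZMod p | m ≠ -1} := by
    rw [← Set.range_comp]
    ext s
    constructor
    · rintro ⟨m, rfl⟩
      by_cases hm : m = -1
      · subst hm
        refine ⟨2, fun h => hp3 (by linear_combination h), ?_⟩
        rw [Function.comp_apply, orb_eq_iff]
        refine ⟨1, fun j => ?_⟩
        simp only [tT]
        have e1 : j + 1 = 2 ↔ j = 1 := by
          constructor <;> intro h <;> linear_combination h
        have e2 : j + 1 = 0 ↔ j = -1 := by
          constructor <;> intro h <;> linear_combination h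
        have e3 : j + 1 = 1 ↔ j = 0 := by
          constructor <;> intro h <;> linear_combination h
        simp only [e1, e2, e3]
        ring
      · exact ⟨m, hm, rfl⟩
    · rintro ⟨m, -, rfl⟩
      exact ⟨m, rfl⟩
  have hinj : Set.InjOn (fun m => orb (tT m)) {m : ZMod p | m ≠ -1} :=
    fun m hm n hn h => orbit_inj hp2 hp3 hm hn h
  rw [h1, Set.InjOn.ncard_image hinj]
  have : {m : ZMod p | m ≠ -1} = ({-1} : Set (ZMod p))ᶜ := by ext; simp
  rw [this, Set.ncard_compl, Set.ncard_singleton, Nat.card_zmod]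

end Tuples

/-- For `p ≥ 5`, the characters `φ` and `ψ` of `P = C_p ≀ C_p` induced from
the linear characters of `A = C_p^p` with tuples `(1,0,…,0)` and `(1,1,0,…,0)` are faithful
and irreducible, and the number of distinct irreducible constituents of `φψ` equals the
number of `P`-orbits (under cyclic shifts) on the `p` tuples
`(2,1,0,…,0), (1,2,0,…,0), (1,1,1,0,…,0), (1,1,0,1,0,…,0), …, (1,1,0,…,0,1)`,
which is exactly `p - 1`. -/
theorem counterexample_constituent_count
    (p : ℕ) [Fact p.Prime] (hp : 5 ≤ p) (lam : Multiplicative (ZMod p) → ℂ)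
    (hlam : IsIrreducibleCharacter (Multiplicative (ZMod p)) lam)
    (hlam' : lam ≠ fun _ => 1) :
    let φ : Wr p → ℂ :=
      inducedFromBase p (tupleChar p lam (fun j => if j = 0 then 1 else 0))
    let ψ : Wr p → ℂ :=
      inducedFromBase p (tupleChar p lam (fun j => if j = 0 ∨ j = 1 then 1 else 0))
    let tuples : Set (ZMod p → ZMod p) :=
      {fun j => if j = 0 then 2 else if j = 1 then 1 else 0,
       fun j => if j = 0 then 1 else if j = 1 then 2 else 0} ∪
        (fun k : ZMod p => fun j : ZMod p =>
            if j = 0 ∨ j = 1 ∨ j = k then (1 : ZMod p) else 0) ''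
          {k : ZMod p | k ≠ 0 ∧ k ≠ 1}
    IsIrreducibleCharacter (Wr p) φ ∧ IsFaithfulCharacter (Wr p) φ ∧
    IsIrreducibleCharacter (Wr p) ψ ∧ IsFaithfulCharacter (Wr p) ψ ∧
    numConstituents (Wr p) (fun g => φ g * ψ g) =
      Set.ncard
        ((fun t : ZMod p → ZMod p =>
            {s : ZMod p → ZMod p | ∃ k : ZMod p, ∀ j : ZMod p, s j = t (j + k)}) ''
          tuples) ∧
    numConstituents (Wr p) (fun g => φ g * ψ g) = p - 1 := by
  intro φ ψ tuples
  have hp1 : (1 : ZMod p) ≠ 0 := one_ne_zero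
  have hp2 : (2 : ZMod p) ≠ 0 := natCast_small_ne hp 2 (by norm_num) (by norm_num)
  have hp3 : (3 : ZMod p) ≠ 0 := natCast_small_ne hp 3 (by norm_num) (by norm_num)
  obtain ⟨e, he, hle⟩ := lam_eq lam hlam hlam'
  have hφ : φ = indT e tA := induced_eq lam e hle _
  have hψ : ψ = indT e tB := by
    rw [← induced_eq lam e hle, ← tB_eq]
  have htup : tuples = Set.range (tT (p := p)) := tuples_eq
  have hprod : (fun g => φ g * ψ g) = fun g => ∑ m : ZMod p, indT e (tT m) g := by
    funext g
    rw [hφ, hψ, indT_prod]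
  have hcard : numConstituents (Wr p) (fun g => φ g * ψ g) =
      Set.ncard ((fun t : ZMod p → ZMod p =>
            {s : ZMod p → ZMod p | ∃ k : ZMod p, ∀ j : ZMod p, s j = t (j + k)}) ''
          tuples) := by
    rw [hprod, htup]
    exact count_eq e he hp3
  refine ⟨?_, ?_, ?_, ?_, hcard, ?_⟩
  · rw [hφ]
    exact indT_irr e he _ (by simp [tA])
  · rw [hφ]
    refine indT_faithful e he _ fun a h => ?_
    funext j
    have := h (-j)
    simpa [tA, add_neg_eq_zero] using this
  · rw [hψ]
    refine indT_irr e he _ ?_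
    simp [tB, Finset.sum_add_distrib]
    norm_num
    exact hp2
  · rw [hψ]
    refine indT_faithful e he _ fun a h => ?_
    have h2 : ∀ j, a j + a (j + 1) = 0 := by
      intro j
      have := h (-j)
      simpa [tB, mul_add, Finset.sum_add_distrib, add_neg_eq_zero, add_neg_eq_iff_eq_add,
        add_comm] using this
    by_contra hne
    obtain ⟨j, hj⟩ := Function.ne_iff.mp hne
    have h3 : ∀ n : ℕ, a (j + n) = (-1) ^ n * a j := by
      intro n
      induction n with
      | zero => simp
      | succ n ih =>
        have := h2 (j + n)
        push_cast
        rw [← add_assoc, eq_neg_of_add_eq_zero_right this, ih]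
        ring
    have h4 := h3 p
    have hodd : Odd p := (Fact.out : p.Prime).odd_of_ne_two (by omega)
    rw [hodd.neg_one_pow, CharP.cast_eq_zero, add_zero] at h4
    have h5 : 2 * a j = 0 := by linear_combination h4
    exact hj ((mul_eq_zero.mp h5).resolve_left hp2)
  · rw [hcard, htup]
    exact orbit_count hp hp2 hp3
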